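/- arXiv:0708.2776 — 2 statements merged into one kernel-verified Lean document; each statement's English description precedes it below -/
import Mathlib

section
/- Every regular bipartite graph of even degree k ≥ 8 is antimagic. -/
open Finset

/-- The vertex-sum of `v` under edge labeling `f`: the sum of labels on edges incident to `v`. -/
def vertexSum {V : Type*} [Fintype V] [DecidableEq V] (G : SimpleGraph V)
    [DecidableRel G.Adj] (f : Sym2 V → ℕ) (v : V) : ℕ :=
  ∑ e ∈ G.incidenceFinset v, f e

/-- A graph is antimagic if some bijective labeling of its edges by `{1, …, |E(G)|}`
has pairwise distinct vertex-sums. -/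
def IsAntimagic {V : Type*} [Fintype V] [DecidableEq V] (G : SimpleGraph V)
    [DecidableRel G.Adj] : Prop :=
  ∃ f : Sym2 V → ℕ,
    Set.BijOn f ↑G.edgeFinset ↑(Finset.Icc 1 G.edgeFinset.card) ∧
    ∀ u v : V, u ≠ v → vertexSum G f u ≠ vertexSum G f v

theorem exists_matching_decomposition {A B : Type*} [Fintype A] [Fintype B] [DecidableEq A]
    [DecidableEq B] (k : ℕ) (R : A → B → Prop) [∀ a b, Decidable (R a b)]
    (hA : ∀ a, #{b | R a b} = k) (hB : ∀ b, #{a | R a b} = k) :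
    ∃ μ : Fin k → A ≃ B, (∀ a b, R a b ↔ ∃ j, μ j a = b) ∧
      ∀ a, Function.Injective fun j => μ j a := by
  induction k generalizing R with
  | zero =>
    refine ⟨Fin.elim0, fun a b => ?_, fun a j => j.elim0⟩
    have h := hA a
    rw [card_eq_zero, filter_eq_empty_iff] at h
    simpa using h (mem_univ b)
  | succ k ih =>
    have hcard : Fintype.card A = Fintype.card B := by
      have := card_mul_eq_card_mul (s := (univ : Finset A)) (t := (univ : Finset B)) R
        (fun a _ => hA a) (fun b _ => hB b)
      exact Nat.eq_of_mul_eq_mul_right k.succ_pos this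
    obtain ⟨f, hf, hRf⟩ :=
      (Finset.all_card_le_biUnion_card_iff_exists_injective
        (fun a => (univ.filter fun b => R a b))).1 fun s => by
          refine Nat.le_of_mul_le_mul_right ?_ k.succ_pos
          refine card_mul_le_card_mul R (fun a ha => ?_) (fun b _ => ?_)
          · refine (hA a).symm.le.trans <| card_le_card fun b hb => ?_
            rw [mem_bipartiteAbove]
            exact ⟨mem_biUnion.2 ⟨a, ha, hb⟩, (mem_filter.1 hb).2⟩
          · refine (card_le_card fun a ha => ?_).trans (hB b).le
            rw [mem_bipartiteBelow] at ha
            simp [ha.2]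
    have hRf : ∀ a, R a (f a) := fun a => (mem_filter.1 (hRf a)).2
    have hbij : Function.Bijective f := (Fintype.bijective_iff_injective_and_card f).2 ⟨hf, hcard⟩
    let e : A ≃ B := Equiv.ofBijective f hbij
    have he : ∀ a, R a (e a) := hRf
    obtain ⟨μ, hμ, hinj⟩ := ih (fun a b => R a b ∧ e a ≠ b)
      (fun a => by
        have : (univ.filter fun b => R a b ∧ e a ≠ b) = (univ.filter fun b => R a b).erase (e a) := by
          ext b; simp only [mem_filter, mem_univ, true_and, mem_erase]; tauto
        rw [this, card_erase_of_mem (by simp [he]), hA]; rfl)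
      (fun b => by
        have : (univ.filter fun a => R a b ∧ e a ≠ b) =
            (univ.filter fun a => R a b).erase (e.symm b) := by
          ext a; simp only [mem_filter, mem_univ, true_and, mem_erase, ne_eq,
            Equiv.eq_symm_apply]; tauto
        rw [this, card_erase_of_mem (by simpa using he (e.symm b)), hB]; rfl)
    refine ⟨Fin.cons e μ, fun a b => ?_, fun a => ?_⟩
    · rw [Fin.exists_fin_succ]
      simp only [Fin.cons_zero, Fin.cons_succ, ← hμ]
      by_cases h : e a = b
      · simpa [h] using h ▸ he a
      · simp [h]
    · have hne : ∀ j, μ j a ≠ e a := fun j h => ((hμ a (e a)).2 ⟨j, h⟩).2 rfl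
      intro i j
      refine Fin.cases ?_ (fun i => ?_) i <;> refine Fin.cases ?_ (fun j => ?_) j
      · simp
      · intro h; exact absurd h.symm (hne j)
      · intro h; exact absurd h (hne i)
      · intro h; exact congrArg Fin.succ (hinj a h)

theorem exists_bool_alternating {B : Type*} (π : Equiv.Perm B) (T : Set B)
    (hT : ∀ b, ∃ i : ℕ, (π ^ i) b ∈ T) :
    ∃ δ : B → Bool, ∀ b ∉ T, δ (π b) ≠ δ b := by
  classical
  refine ⟨fun b => decide (Even (Nat.find (hT b))), fun b hb => ?_⟩
  have h0 : Nat.find (hT b) = Nat.find (hT (π b)) + 1 := by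
    rw [Nat.find_eq_iff]
    refine ⟨by simpa [pow_succ] using Nat.find_spec (hT (π b)), fun i hi => ?_⟩
    cases i with
    | zero => simpa using hb
    | succ i => simpa [pow_succ] using Nat.find_min (hT (π b)) (by omega : i < _)
  simp only [ne_eq, decide_eq_decide, h0, Nat.even_add_one]
  tauto

theorem exists_set_meeting_cycles {B : Type*} [Finite B] (π₁ π₂ : Equiv.Perm B)
    (h₁ : ∀ b, π₁ b ≠ b) (h₂ : ∀ b, π₂ b ≠ b) :
    ∃ T : Set B, (∀ b, ∃ i : ℕ, (π₁ ^ i) b ∈ T) ∧ ∀ b, ∃ i : ℕ, (π₂ ^ i) b ∉ T := by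
  classical
  cases nonempty_fintype B
  let q₁ : B → Quotient (Equiv.Perm.SameCycle.setoid π₁) := Quotient.mk _
  let q₂ : B → Quotient (Equiv.Perm.SameCycle.setoid π₂) := Quotient.mk _
  have hq₁ : ∀ b, q₁ (π₁ b) = q₁ b := fun b =>
    Quotient.sound (Equiv.Perm.sameCycle_apply_left.2 (Equiv.Perm.SameCycle.refl _ _))
  have hq₂ : ∀ b, q₂ (π₂ b) = q₂ b := fun b =>
    Quotient.sound (Equiv.Perm.sameCycle_apply_left.2 (Equiv.Perm.SameCycle.refl _ _))
  let r : Quotient (Equiv.Perm.SameCycle.setoid π₁) ⊕ Quotient (Equiv.Perm.SameCycle.setoid π₂) →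
    B → Prop := fun i b => i = Sum.inl (q₁ b) ∨ i = Sum.inr (q₂ b)
  have htwo : ∀ i, 2 ≤ #{b | r i b} := by
    rintro (i | i) <;> induction i using Quotient.inductionOn with | _ b
    · rw [← card_pair (h₁ b)]
      refine card_le_card fun x hx => ?_
      rcases mem_insert.1 hx with rfl | hx
      · simpa [r] using (hq₁ b).symm
      · rw [mem_singleton.1 hx]; simp [r, q₁]
    · rw [← card_pair (h₂ b)]
      refine card_le_card fun x hx => ?_
      rcases mem_insert.1 hx with rfl | hx
      · simpa [r] using (hq₂ b).symm
      · rw [mem_singleton.1 hx]; simp [r, q₂]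
  obtain ⟨f, hf, hrf⟩ :=
    (Finset.all_card_le_biUnion_card_iff_exists_injective
      (fun i => (univ.filter fun b => r i b))).1 fun s => by
        refine Nat.le_of_mul_le_mul_right ?_ two_pos
        refine card_mul_le_card_mul r (fun i hi => ?_) (fun b _ => ?_)
        · refine (htwo i).trans (card_le_card fun b hb => ?_)
          rw [mem_bipartiteAbove]
          exact ⟨mem_biUnion.2 ⟨i, hi, hb⟩, (mem_filter.1 hb).2⟩
        · refine (card_le_card fun i hi => ?_).trans
            (card_le_two (a := Sum.inl (q₁ b)) (b := Sum.inr (q₂ b)))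
          rw [mem_bipartiteBelow] at hi
          simpa [r] using hi.2
  have hrf : ∀ i, r i (f i) := fun i => (mem_filter.1 (hrf i)).2
  refine ⟨Set.range (f ∘ Sum.inl), fun b => ?_, fun b => ?_⟩
  · have h : q₁ b = q₁ (f (Sum.inl (q₁ b))) := by simpa [r] using hrf (Sum.inl (q₁ b))
    obtain ⟨i, hi⟩ := (Quotient.exact h : π₁.SameCycle b _).exists_nat_pow_eq
    exact ⟨i, _, hi.symm⟩
  · have h : q₂ b = q₂ (f (Sum.inr (q₂ b))) := by simpa [r] using hrf (Sum.inr (q₂ b))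
    obtain ⟨i, hi⟩ := (Quotient.exact h : π₂.SameCycle b _).exists_nat_pow_eq
    refine ⟨i, ?_⟩
    rintro ⟨x, hx⟩
    rw [hi] at hx
    exact absurd (hf hx) (by simp)

theorem exists_equiv_fin_monotone {B : Type*} [Fintype B] {n : ℕ} (hn : Fintype.card B = n)
    (q : B → ℕ) : ∃ t : B ≃ Fin n, ∀ b b', t b ≤ t b' → q b ≤ q b' := by
  let e := Fintype.equivFinOfCardEq hn
  refine ⟨e.trans (Tuple.sort (q ∘ e.symm)).symm, fun b b' h => ?_⟩
  simpa using Tuple.monotone_sort (q ∘ e.symm) h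

/-- The quotient, on division by `m`, of the label (minus one) in row `i` and column `(r, e)` of
the labeling table; `t` is used only by the last column `(m - 1, true)`. -/
def tableSlot (m n i t r : ℕ) (e : Bool) : ℕ :=
  if r = 0 then if e then n + i else i
  else if r = m - 1 then if e then 2 * t + 1 else 2 * (n - 1 - i)
  else if e then 2 * n - 1 - i else i

/-- The entry in row `i` and column `j` of the labeling table. -/
def tableLabel (m n i t : ℕ) (j : Fin m × Bool) : ℕ :=
  m * tableSlot m n i t j.1 j.2 + j.1 + 1

theorem tableLabel_mem_Icc {m n i t : ℕ} (hi : i < n) (ht : t < n) (j : Fin m × Bool) :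
    tableLabel m n i t j ∈ Icc 1 (2 * m * n) := by
  obtain ⟨r, e⟩ := j
  have h : tableSlot m n i t r e + 1 ≤ 2 * n := by
    unfold tableSlot
    split_ifs <;> omega
  have h' := Nat.mul_le_mul_left m h
  have hr := r.2
  simp only [tableLabel, mem_Icc]
  constructor
  · omega
  · calc _ ≤ m * (tableSlot m n i t r e + 1) := by rw [mul_add]; omega
      _ ≤ _ := h'
      _ = _ := by ring

theorem tableLabel_injective {m n i i' t t' : ℕ} (hi : i < n) (hi' : i' < n)
    (hm : 2 ≤ m) (htt : t = t' → i = i') {j j' : Fin m × Bool}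
    (h : tableLabel m n i t j = tableLabel m n i' t' j') : i = i' ∧ j = j' := by
  obtain ⟨r, e⟩ := j
  obtain ⟨r', e'⟩ := j'
  simp only [tableLabel, Nat.add_right_cancel_iff] at h
  have hr : (r : ℕ) = r' := by
    have := congrArg (· % m) h
    simpa [Nat.mul_add_mod, Nat.mod_eq_of_lt] using this
  have hs : tableSlot m n i t r e = tableSlot m n i' t' r' e' := by
    rw [hr, Nat.add_right_cancel_iff] at h
    rw [hr]
    exact Nat.eq_of_mul_eq_mul_left (by omega) h
  rw [hr] at hs
  have : i = i' ∧ e = e' := by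
    unfold tableSlot at hs
    cases e <;> cases e' <;> simp at hs ⊢ <;> split_ifs at hs <;> omega
  exact ⟨this.1, Prod.ext (Fin.ext hr) this.2⟩

theorem exists_sum_tableLabel {m : ℕ} (hm : 2 ≤ m) (n : ℕ) :
    ∃ C : ℤ, ∀ i t, i < n → ((∑ j, tableLabel m n i t j : ℕ) : ℤ) = C + 2 * m * t := by
  let a : Fin m := ⟨0, by omega⟩
  let z : Fin m := ⟨m - 1, by omega⟩
  refine ⟨∑ r : Fin m, ((m : ℤ) * (if r = a then (n : ℤ) else 2 * n - 1) + 2 * (r + 1)),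
    fun i t hi => ?_⟩
  have key : ∀ r : Fin m,
      ((tableLabel m n i t (r, true) + tableLabel m n i t (r, false) : ℕ) : ℤ) =
      ((m : ℤ) * (if r = a then (n : ℤ) else 2 * n - 1) + 2 * (r + 1)) +
        ((if r = a then (m : ℤ) * (2 * i) else 0) +
          (if r = z then (m : ℤ) * (2 * t - 2 * i) else 0)) := by
    intro r
    have hs : ((tableSlot m n i t r true + tableSlot m n i t r false : ℕ) : ℤ) =
        (if r = a then (n : ℤ) else 2 * n - 1) + (if r = a then 2 * (i : ℤ) else 0) +
          (if r = z then (2 * t - 2 * i : ℤ) else 0) := by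
      simp only [tableSlot, Fin.ext_iff, a, z, if_true, Bool.false_eq_true, if_false]
      split_ifs <;> omega
    simp only [tableLabel]
    have : (m : ℤ) * ((tableSlot m n i t r true + tableSlot m n i t r false : ℕ) : ℤ) = _ :=
      congrArg _ hs
    push_cast at this ⊢
    rw [← mul_ite_zero (P := r = a), ← mul_ite_zero (P := r = z)]
    linarith
  rw [Fintype.sum_prod_type]
  simp only [Fintype.sum_bool]
  rw [Nat.cast_sum, sum_congr rfl fun r _ => key r]
  simp only [sum_add_distrib, sum_ite_eq', mem_univ, if_true]
  ring

/-- The permutation exchanging `p₀` with `p₁` if `x` holds, and `p₂` with `p₃` if `y` holds. -/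
def doubleSwap {J : Type*} [DecidableEq J] (p₀ p₁ p₂ p₃ : J) (x y : Bool) : Equiv.Perm J :=
  (if x then Equiv.swap p₀ p₁ else 1) * (if y then Equiv.swap p₂ p₃ else 1)

theorem doubleSwap_apply_of_ne {J : Type*} [DecidableEq J] {p₀ p₁ p₂ p₃ j : J} (x y : Bool)
    (h₀ : j ≠ p₀) (h₁ : j ≠ p₁) (h₂ : j ≠ p₂) (h₃ : j ≠ p₃) :
    doubleSwap p₀ p₁ p₂ p₃ x y j = j := by
  cases x <;> cases y <;> simp [doubleSwap, Equiv.swap_apply_of_ne_of_ne, *]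

theorem sum_doubleSwap {J : Type*} [Fintype J] [DecidableEq J] {p₀ p₁ p₂ p₃ : J}
    (h₀₁ : p₀ ≠ p₁) (h₀₂ : p₀ ≠ p₂) (h₀₃ : p₀ ≠ p₃) (h₁₂ : p₁ ≠ p₂) (h₁₃ : p₁ ≠ p₃)
    (h₂₃ : p₂ ≠ p₃) (ρ : J → ℤ) (x y : J → Bool) :
    ∑ j, ρ (doubleSwap p₀ p₁ p₂ p₃ (x j) (y j) j) = ∑ j, ρ j +
      (((x p₀).toNat - (x p₁).toNat) * (ρ p₁ - ρ p₀) +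
        ((y p₂).toNat - (y p₃).toNat) * (ρ p₃ - ρ p₂)) := by
  have key : ∀ j, ρ (doubleSwap p₀ p₁ p₂ p₃ (x j) (y j) j) = ρ j +
      ((if j = p₀ then (x p₀).toNat * (ρ p₁ - ρ p₀) else 0) +
       (if j = p₁ then (x p₁).toNat * (ρ p₀ - ρ p₁) else 0) +
       (if j = p₂ then (y p₂).toNat * (ρ p₃ - ρ p₂) else 0) +
       (if j = p₃ then (y p₃).toNat * (ρ p₂ - ρ p₃) else 0)) := by
    intro j
    by_cases h₀ : j = p₀
    · subst h₀
      cases hx : x j <;> cases hy : y j <;>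
        simp [doubleSwap, Equiv.swap_apply_of_ne_of_ne, *]
    by_cases h₁ : j = p₁
    · subst h₁
      cases hx : x j <;> cases hy : y j <;>
        simp [doubleSwap, Equiv.swap_apply_of_ne_of_ne, *]
    by_cases h₂ : j = p₂
    · subst h₂
      cases hx : x j <;> cases hy : y j <;>
        simp [doubleSwap, Equiv.swap_apply_of_ne_of_ne, *, h₀₃.symm, h₁₃.symm]
    by_cases h₃ : j = p₃
    · subst h₃
      cases hx : x j <;> cases hy : y j <;>
        simp [doubleSwap, Equiv.swap_apply_of_ne_of_ne h₀₂.symm h₁₂.symm,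
          Equiv.swap_apply_of_ne_of_ne h₀₃.symm h₁₃.symm, *]
    rw [doubleSwap_apply_of_ne _ _ h₀ h₁ h₂ h₃]
    simp [*]
  rw [sum_congr rfl fun j _ => key j]
  simp only [sum_add_distrib, sum_ite_eq', mem_univ, if_true]
  ring

theorem exists_labeling_of_matchings {A B : Type*} [Fintype A] [Fintype B] {m : ℕ} (hm : 4 ≤ m)
    (μ : Fin m × Bool → A ≃ B) (hμ : ∀ a, Function.Injective fun j => μ j a) :
    ∃ g : A → Fin m × Bool → ℕ, Function.Injective (Function.uncurry g) ∧
      (∀ a j, g a j ∈ Icc 1 (2 * m * Fintype.card A)) ∧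
      (Function.Injective fun a => ∑ j, g a j) ∧
      (Function.Injective fun b => ∑ j, g ((μ j).symm b) j) ∧
      ∀ a b, ∑ j, g a j ≠ ∑ j, g ((μ j).symm b) j := by
  classical
  set n := Fintype.card A with hn
  let p₀ : Fin m × Bool := (⟨0, by omega⟩, false)
  let p₁ : Fin m × Bool := (⟨1, by omega⟩, false)
  let p₂ : Fin m × Bool := (⟨0, by omega⟩, true)
  let p₃ : Fin m × Bool := (⟨2, by omega⟩, true)
  let l : Fin m × Bool := (⟨m - 1, by omega⟩, true)
  have h₀₁ : p₀ ≠ p₁ := by simp [p₀, p₁]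
  have h₀₂ : p₀ ≠ p₂ := by simp [p₀, p₂]
  have h₀₃ : p₀ ≠ p₃ := by simp [p₀, p₃]
  have h₁₂ : p₁ ≠ p₂ := by simp [p₁, p₂]
  have h₁₃ : p₁ ≠ p₃ := by simp [p₁, p₃]
  have h₂₃ : p₂ ≠ p₃ := by simp [p₂, p₃]
  have hl₀ : l ≠ p₀ := by simp [l, p₀]
  have hl₁ : l ≠ p₁ := by simp [l, p₁]
  have hl₂ : l ≠ p₂ := by simp [l, p₂]; omega
  have hl₃ : l ≠ p₃ := by simp [l, p₃]; omega
  -- Choose which rows are swapped, so that every vertex of `B` sees an unbalanced swap.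
  obtain ⟨T, hT₁, hT₂⟩ := exists_set_meeting_cycles ((μ p₀).symm.trans (μ p₁))
    ((μ p₂).symm.trans (μ p₃))
    (fun b h => h₀₁ (hμ ((μ p₀).symm b) (by simpa using h.symm)))
    (fun b h => h₂₃ (hμ ((μ p₂).symm b) (by simpa using h.symm)))
  obtain ⟨δ₁, hδ₁⟩ := exists_bool_alternating _ T hT₁
  obtain ⟨δ₂, hδ₂⟩ := exists_bool_alternating _ Tᶜ hT₂
  let x : A → Bool := fun a => δ₁ (μ p₁ a)
  let y : A → Bool := fun a => δ₂ (μ p₃ a)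
  have hxy : ∀ b, x ((μ p₀).symm b) ≠ x ((μ p₁).symm b) ∨
      y ((μ p₂).symm b) ≠ y ((μ p₃).symm b) := by
    intro b
    by_cases hb : b ∈ T
    · exact .inr (by simpa [y] using hδ₂ b (by simpa using hb))
    · exact .inl (by simpa [x] using hδ₁ b hb)
  let σ : A → Equiv.Perm (Fin m × Bool) := fun a => doubleSwap p₀ p₁ p₂ p₃ (x a) (y a)
  have hσl : ∀ a, σ a l = l := fun a => doubleSwap_apply_of_ne _ _ hl₀ hl₁ hl₂ hl₃
  let i : A ≃ Fin n := Fintype.equivFin A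
  -- The labels of the last matching are assigned according to the partial sums on `B`.
  let q : B → ℕ := fun b =>
    ∑ j ∈ univ.erase l, tableLabel m n (i ((μ j).symm b)) 0 (σ ((μ j).symm b) j)
  obtain ⟨t, ht⟩ := exists_equiv_fin_monotone (Fintype.card_congr (μ l)).symm q
  let g : A → Fin m × Bool → ℕ := fun a j => tableLabel m n (i a) (t (μ l a)) (σ a j)
  have hsumA : ∀ a, ∑ j, g a j = ∑ j, tableLabel m n (i a) (t (μ l a)) j := fun a =>
    Equiv.sum_comp (σ a) (tableLabel m n (i a) (t (μ l a)))
  obtain ⟨C, hC⟩ := exists_sum_tableLabel (by omega : 2 ≤ m) n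
  have hsumB : ∀ b, ∑ j, g ((μ j).symm b) j = q b + 2 * m * (t b + 1) := by
    intro b
    rw [← sum_erase_add _ _ (mem_univ l)]
    congr 1
    · refine sum_congr rfl fun j hj => ?_
      have hj' : σ ((μ j).symm b) j ≠ l := fun h =>
        (mem_erase.1 hj).1 ((σ ((μ j).symm b)).injective (h.trans (hσl _).symm))
      have : ¬ (((σ ((μ j).symm b) j).1 : ℕ) = m - 1 ∧ (σ ((μ j).symm b) j).2 = true) :=
        fun h => hj' (Prod.ext (Fin.ext h.1) h.2)
      simp only [g, tableLabel, tableSlot]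
      split_ifs <;> tauto
    · simp only [g, hσl]
      have : m - 1 ≠ 0 := by omega
      simp only [tableLabel, tableSlot, l, this, if_true, if_false, Equiv.apply_symm_apply]
      rw [add_assoc, Nat.sub_add_cancel (by omega)]
      ring
  -- Modulo `m`, all sums over `A` agree, and no sum over `B` agrees with them.
  let ρ : Fin m × Bool → ℤ := fun j => (j.1 : ℤ) + 1
  have hρ : ∀ i t j, (tableLabel m n i t j : ℤ) ≡ ρ j [ZMOD m] := by
    intro i t j
    refine (Int.modEq_iff_dvd.2 ⟨tableSlot m n i t j.1 j.2, ?_⟩).symm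
    simp only [tableLabel, ρ]
    push_cast
    ring
  have hmodA : ∀ a, ((∑ j, g a j : ℕ) : ℤ) ≡ ∑ j, ρ j [ZMOD m] := by
    intro a
    rw [hsumA, Nat.cast_sum]
    exact Int.ModEq.sum fun j _ => hρ _ _ _
  have hmodB : ∀ b, ((∑ j, g ((μ j).symm b) j : ℕ) : ℤ) ≡
      ∑ j, ρ (σ ((μ j).symm b) j) [ZMOD m] := by
    intro b
    rw [Nat.cast_sum]
    exact Int.ModEq.sum fun j _ => hρ _ _ _
  refine ⟨g, ?_, fun a j => tableLabel_mem_Icc (i a).2 ?_ _, fun a a' h => ?_, fun b b' h => ?_,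
    fun a b h => ?_⟩
  · rintro ⟨a, j⟩ ⟨a', j'⟩ h
    obtain ⟨h₁, h₂⟩ := tableLabel_injective (i a).2 (i a').2 (by omega)
      (fun h => congrArg _ (congrArg i ((μ l).injective (t.injective (Fin.ext h))))) h
    obtain rfl := i.injective (Fin.ext h₁)
    exact congrArg (Prod.mk a) ((σ a).injective h₂)
  · exact (t (μ l a)).2
  · simp only at h
    rw [hsumA, hsumA, ← @Nat.cast_inj ℤ, hC _ _ (i a).2, hC _ _ (i a').2] at h
    have h2 := mul_left_cancel₀ (by positivity) (add_left_cancel h)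
    exact (μ l).injective (t.injective (Fin.ext (by exact_mod_cast h2)))
  · simp only [hsumB] at h
    have hlt : ∀ b b', t b < t b' → q b + 2 * m * (t b + 1) < q b' + 2 * m * (t b' + 1) :=
      fun b b' hb => add_lt_add_of_le_of_lt (ht _ _ hb.le) (by gcongr; exact hb)
    rcases lt_trichotomy (t b) (t b') with hb | hb | hb
    · exact absurd h (hlt _ _ hb).ne
    · exact t.injective hb
    · exact absurd h (hlt _ _ hb).ne'
  · have hdvd := ((hmodA a).symm.trans (h ▸ hmodB b)).dvd
    rw [sum_doubleSwap h₀₁ h₀₂ h₀₃ h₁₂ h₁₃ h₂₃ ρ (fun j => x ((μ j).symm b))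
      (fun j => y ((μ j).symm b)), add_sub_cancel_left] at hdvd
    have hb := hxy b
    simp only [ρ, p₀, p₁, p₂, p₃] at hdvd hb
    revert hdvd hb
    generalize x _ = x₀
    generalize x _ = x₁
    generalize y _ = y₂
    generalize y _ = y₃
    intro hdvd hb
    refine absurd (Int.eq_zero_of_abs_lt_dvd hdvd ?_) ?_
    · refine lt_of_lt_of_le (b := 4) ?_ (by exact_mod_cast hm)
      clear hdvd hb
      cases x₀ <;> cases x₁ <;> cases y₂ <;> cases y₃ <;> simp
    · clear hdvd
      cases x₀ <;> cases x₁ <;> cases y₂ <;> cases y₃ <;> simp at hb ⊢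

theorem stmt_16 {V : Type*} [Fintype V] [DecidableEq V] (G : SimpleGraph V)
    [DecidableRel G.Adj] (k : ℕ) (hk : 8 ≤ k) (heven : Even k)
    (c : V → Bool) (hbip : ∀ u v, G.Adj u v → c u ≠ c v)
    (hreg : G.IsRegularOfDegree k) : IsAntimagic G := by
  obtain ⟨m, hm⟩ := heven.two_dvd
  subst hm
  let A := {v : V // c v = true}
  let B := {v : V // c v = false}
  have hA : ∀ a : A, #{b : B | G.Adj a b} = 2 * m := by
    intro a
    rw [← hreg a, ← G.card_neighborFinset_eq_degree, ← card_map (Function.Embedding.subtype _)]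
    congr 1
    ext v
    have := hbip a v
    simp only [a.2] at this
    simp only [mem_map, mem_filter, mem_univ, true_and, Function.Embedding.subtype_apply,
      SimpleGraph.mem_neighborFinset]
    constructor
    · rintro ⟨b, hb, rfl⟩
      exact hb
    · exact fun h => ⟨⟨v, by simpa using (this h).symm⟩, h, rfl⟩
  have hB : ∀ b : B, #{a : A | G.Adj a b} = 2 * m := by
    intro b
    rw [← hreg b, ← G.card_neighborFinset_eq_degree, ← card_map (Function.Embedding.subtype _)]
    congr 1
    ext v
    have := hbip v b
    simp only [b.2] at this
    simp only [mem_map, mem_filter, mem_univ, true_and, Function.Embedding.subtype_apply,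
      SimpleGraph.mem_neighborFinset]
    constructor
    · rintro ⟨a, ha, rfl⟩
      exact ha.symm
    · exact fun h => ⟨⟨v, by simpa using this h.symm⟩, h.symm, rfl⟩
  obtain ⟨μ', hadj', hinj'⟩ := exists_matching_decomposition (2 * m)
    (fun (a : A) (b : B) => G.Adj a b) hA hB
  let ψ : Fin m × Bool ≃ Fin (2 * m) :=
    Fintype.equivFinOfCardEq (by simp [mul_comm])
  let μ : Fin m × Bool → A ≃ B := fun j => μ' (ψ j)
  have hadj : ∀ (a : A) (b : B), G.Adj a b ↔ ∃ j, μ j a = b := fun a b =>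
    (hadj' a b).trans ψ.surjective.exists
  have hinj : ∀ a, Function.Injective fun j => μ j a := fun a => (hinj' a).comp ψ.injective
  obtain ⟨g, hg, hIcc, hgA, hgB, hgAB⟩ := exists_labeling_of_matchings (by omega) μ hinj
  let Φ : A × (Fin m × Bool) → Sym2 V := fun p => s((p.1 : V), (μ p.2 p.1 : V))
  have hne : ∀ (a : A) (b : B), (a : V) ≠ b := fun a b h => by
    have h₁ := a.2
    rw [h, b.2] at h₁
    exact absurd h₁ (by simp)
  have hΦ : Function.Injective Φ := by
    rintro ⟨a, j⟩ ⟨a', j'⟩ h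
    rcases Sym2.eq_iff.1 h with ⟨h₁, h₂⟩ | ⟨h₁, -⟩
    · obtain rfl := Subtype.ext h₁
      exact congrArg (Prod.mk a) (hinj a (Subtype.ext h₂))
    · exact absurd h₁ (hne _ _)
  have hΦE : univ.image Φ = G.edgeFinset := by
    ext e
    induction e using Sym2.ind with | _ u v
    simp only [mem_image, mem_univ, true_and, SimpleGraph.mem_edgeFinset,
      SimpleGraph.mem_edgeSet]
    constructor
    · rintro ⟨⟨a, j⟩, h⟩
      rw [← SimpleGraph.mem_edgeSet, ← h]
      exact (hadj _ _).2 ⟨j, rfl⟩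
    · intro h
      cases hu : c u with
      | true =>
        have hv : c v = false := by simpa [hu] using (hbip u v h).symm
        obtain ⟨j, hj⟩ := (hadj ⟨u, hu⟩ ⟨v, hv⟩).1 h
        exact ⟨(⟨u, hu⟩, j), by simp [Φ, hj]⟩
      | false =>
        have hv : c v = true := by simpa [hu] using (hbip u v h).symm
        obtain ⟨j, hj⟩ := (hadj ⟨v, hv⟩ ⟨u, hu⟩).1 h.symm
        exact ⟨(⟨v, hv⟩, j), by simp [Φ, hj, Sym2.eq_swap]⟩
  have hcardE : G.edgeFinset.card = 2 * m * Fintype.card A := by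
    rw [← hΦE, card_image_of_injective _ hΦ, card_univ]
    simp
    ring
  let f : Sym2 V → ℕ := Function.extend Φ (Function.uncurry g) 0
  have hf : ∀ a j, f (Φ (a, j)) = g a j := fun a j => hΦ.extend_apply _ _ (a, j)
  have hsumA : ∀ a : A, vertexSum G f a = ∑ j, g a j := by
    intro a
    have : G.incidenceFinset a = univ.image fun j => Φ (a, j) := by
      ext e
      rw [SimpleGraph.incidenceFinset_eq_filter, ← hΦE]
      simp only [mem_filter, mem_image, mem_univ, true_and]
      constructor
      · rintro ⟨⟨⟨a', j⟩, rfl⟩, h⟩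
        rcases Sym2.mem_iff.1 h with h | h
        · exact ⟨j, by rw [Subtype.ext h]⟩
        · exact absurd h (hne _ _)
      · rintro ⟨j, rfl⟩
        exact ⟨⟨(a, j), rfl⟩, Sym2.mem_mk_left _ _⟩
    rw [vertexSum, this, sum_image fun j _ j' _ h => (Prod.ext_iff.1 (hΦ h)).2]
    simp only [hf]
  have hsumB : ∀ b : B, vertexSum G f b = ∑ j, g ((μ j).symm b) j := by
    intro b
    have : G.incidenceFinset b = univ.image fun j => Φ ((μ j).symm b, j) := by
      ext e
      rw [SimpleGraph.incidenceFinset_eq_filter, ← hΦE]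
      simp only [mem_filter, mem_image, mem_univ, true_and]
      constructor
      · rintro ⟨⟨⟨a, j⟩, rfl⟩, h⟩
        rcases Sym2.mem_iff.1 h with h | h
        · exact absurd h.symm (hne _ _)
        · exact ⟨j, by rw [Subtype.ext h, Equiv.symm_apply_apply]⟩
      · rintro ⟨j, rfl⟩
        exact ⟨⟨(_, j), rfl⟩, by simp [Φ]⟩
    rw [vertexSum, this, sum_image fun j _ j' _ h => (Prod.ext_iff.1 (hΦ h)).2]
    simp only [hf]
  refine ⟨f, ?_, fun u v huv h => huv ?_⟩
  · have hmaps : Set.InjOn f G.edgeFinset := by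
      rw [← hΦE, coe_image, coe_univ, Set.image_univ]
      rintro _ ⟨⟨a, j⟩, rfl⟩ _ ⟨⟨a', j'⟩, rfl⟩ h
      rw [hf, hf] at h
      rw [hg (a₁ := (a, j)) (a₂ := (a', j')) h]
    have himage : G.edgeFinset.image f = Icc 1 G.edgeFinset.card := by
      refine eq_of_subset_of_card_le ?_ ?_
      · rw [hcardE, ← hΦE, image_image]
        intro x hx
        obtain ⟨⟨a, j⟩, -, rfl⟩ := mem_image.1 hx
        rw [Function.comp_apply, hf]
        exact hIcc a j
      · rw [card_image_of_injOn hmaps, Nat.card_Icc, Nat.add_sub_cancel]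
    rw [← himage, coe_image]
    exact hmaps.bijOn_image
  · cases hu : c u <;> cases hv : c v
    · rw [hsumB ⟨u, hu⟩, hsumB ⟨v, hv⟩] at h
      exact congrArg Subtype.val (hgB h)
    · rw [hsumB ⟨u, hu⟩, hsumA ⟨v, hv⟩] at h
      exact absurd h.symm (hgAB _ _)
    · rw [hsumA ⟨u, hu⟩, hsumB ⟨v, hv⟩] at h
      exact absurd h (hgAB _ _)
    · rw [hsumA ⟨u, hu⟩, hsumA ⟨v, hv⟩] at h
      exact congrArg Subtype.val (hgA h)
end

section
/- Every k-regular bipartite graph with k ≥ 2 is antimagic. -/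
open Finset

/-- König: a `k`-regular bipartite relation is a disjoint union of `k` perfect matchings. -/
theorem exists_matching_decomposition_s17 {α β : Type*} [Fintype α] [Fintype β] [DecidableEq α]
    [DecidableEq β] (k : ℕ) (N : α → Finset β) (hα : ∀ a, #(N a) = k)
    (hβ : ∀ b, #{a | b ∈ N a} = k) :
    ∃ ψ : Fin k → α ≃ β, (∀ a b, b ∈ N a ↔ ∃ i, ψ i a = b) ∧
      ∀ a, Function.Injective fun i => ψ i a := by
  induction k generalizing N with
  | zero =>
    refine ⟨fun i => i.elim0, fun a b => ?_, fun a i => i.elim0⟩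
    have := Finset.card_eq_zero.1 (hα a)
    simp [this]
  | succ k ih =>
    have hall : ∀ s : Finset α, #s ≤ #(s.biUnion N) := by
      intro s
      have := Finset.card_mul_le_card_mul (s := s) (t := s.biUnion N) (fun a b => b ∈ N a)
        (m := k + 1) (n := k + 1) ?_ ?_
      · exact Nat.le_of_mul_le_mul_right this k.succ_pos
      · intro a ha
        rw [← hα a]
        refine Finset.card_le_card fun b hb => ?_
        simp only [Finset.bipartiteAbove, Finset.mem_filter, Finset.mem_biUnion]
        exact ⟨⟨a, ha, hb⟩, hb⟩
      · intro b _
        rw [← hβ b]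
        refine Finset.card_le_card fun a ha => ?_
        simp only [Finset.bipartiteBelow, Finset.mem_filter] at ha
        simpa using ha.2
    obtain ⟨f, hf, hfN⟩ := (Finset.all_card_le_biUnion_card_iff_exists_injective N).1 hall
    have hcard : Fintype.card β ≤ Fintype.card α := by
      have := Finset.card_mul_le_card_mul (s := (univ : Finset β)) (t := (univ : Finset α))
        (fun b a => b ∈ N a) (m := k + 1) (n := k + 1) ?_ ?_
      · exact Nat.le_of_mul_le_mul_right this k.succ_pos
      · intro b _
        exact (hβ b).ge
      · intro a _
        rw [← hα a]
        refine Finset.card_le_card fun b hb => ?_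
        simpa [Finset.bipartiteBelow] using hb
    have hbij : Function.Bijective f :=
      (Fintype.bijective_iff_injective_and_card f).2
        ⟨hf, le_antisymm (Fintype.card_le_of_injective f hf) hcard⟩
    let e : α ≃ β := Equiv.ofBijective f hbij
    have he : ∀ a, e a ∈ N a := hfN
    obtain ⟨ψ, hψ, hinj⟩ := ih (fun a => (N a).erase (e a))
      (fun a => by rw [Finset.card_erase_of_mem (he a), hα a]; rfl)
      (fun b => by
        have : ({a | b ∈ (N a).erase (e a)} : Finset α)
            = ({a | b ∈ N a} : Finset α).erase (e.symm b) := by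
          ext a
          simp only [Finset.mem_filter, Finset.mem_univ, true_and, Finset.mem_erase, ne_eq,
            Equiv.eq_symm_apply, eq_comm]
        rw [this, Finset.card_erase_of_mem, hβ b]
        · rfl
        · simpa using he (e.symm b))
    refine ⟨Fin.cons e ψ, fun a b => ?_, fun a => ?_⟩
    · rw [Fin.exists_fin_succ]
      simp only [Fin.cons_zero, Fin.cons_succ, ← hψ, Finset.mem_erase]
      by_cases h : e a = b
      · subst h
        simp [he a]
      · simp [h, Ne.symm h]
    · have hne : ∀ i, ψ i a ≠ e a := fun i h => by
        have := (hψ a (ψ i a)).2 ⟨i, rfl⟩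
        rw [h] at this
        simp at this
      intro i j
      refine Fin.cases ?_ (fun i => ?_) i <;> refine Fin.cases ?_ (fun j => ?_) j
      · simp
      · exact fun h => absurd (Eq.symm h) (hne j)
      · exact fun h => absurd h (hne i)
      · exact fun h => congrArg Fin.succ (hinj a h)

/-- A permutation without fixed points admits a two-colouring whose monochromatic steps are
few and isolated. -/
theorem exists_coloring_of_fixedPointFree {α : Type*} [Fintype α] [DecidableEq α]
    (σ : Equiv.Perm α) (hσ : ∀ a, σ a ≠ a) :
    ∃ t : α → Bool, (∀ a, t a = t (σ a) → t (σ a) ≠ t (σ (σ a))) ∧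
      3 * #{a | t a = t (σ a)} ≤ Fintype.card α ∧
      2 * #{a | t a = true ∧ t (σ a) = false} ≤ Fintype.card α ∧
      2 * #{a | t a = false ∧ t (σ a) = true} ≤ Fintype.card α ∧
      #{a | t a = t (σ a)} ≤ #{a | t a = true ∧ t (σ a) = false} ∧
      #{a | t a = t (σ a)} ≤ #{a | t a = false ∧ t (σ a) = true} := by
  let D : (α → Bool) → Finset α := fun t => {a | t a = t (σ a)}
  have hD : ∀ t a, a ∈ D t ↔ t a = t (σ a) := by simp [D]
  obtain ⟨t, ht⟩ := Finite.exists_min fun t => #(D t)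
  let flip : (α → Bool) → α → (α → Bool) := fun t c => Function.update t c (!t c)
  have flip_self : ∀ t a, σ a ∈ D (flip t (σ a)) ↔ σ a ∉ D t := by
    intro t a
    simp only [hD, flip, Function.update_self, Function.update_of_ne (hσ (σ a))]
    cases t (σ a) <;> cases t (σ (σ a)) <;> simp
  have flip_prev : ∀ t a, a ∈ D (flip t (σ a)) ↔ a ∉ D t := by
    intro t a
    simp only [hD, flip, Function.update_self, Function.update_of_ne (hσ a).symm]
    cases t a <;> cases t (σ a) <;> simp
  have flip_other : ∀ t a c, c ≠ a → c ≠ σ a → (c ∈ D (flip t (σ a)) ↔ c ∈ D t) := by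
    intro t a c h1 h2
    have h3 : σ c ≠ σ a := fun h => h1 (σ.injective h)
    simp only [hD, flip, Function.update_of_ne h2, Function.update_of_ne h3]
  have isolated : ∀ t, (∀ t', #(D t) ≤ #(D t')) → ∀ a ∈ D t, σ a ∉ D t := by
    intro t ht a ha hσa
    refine (ht (flip t (σ a))).not_gt (Finset.card_lt_card ?_)
    refine Finset.ssubset_iff_subset_ne.2 ⟨fun c hc => ?_, fun h => ?_⟩
    · by_cases h1 : c = a
      · exact h1 ▸ ha
      by_cases h2 : c = σ a
      · exact h2 ▸ hσa
      exact (flip_other t a c h1 h2).1 hc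
    · exact (flip_prev t a).1 (h ▸ ha) ha
  have h1 := isolated t ht
  have h2 : ∀ a ∈ D t, σ (σ a) ∉ D t := by
    intro a ha hc
    have hσa := h1 a ha
    have hne : σ (σ a) ≠ a := fun h => hσa <| by
      rw [hD] at ha ⊢
      rw [h, ha]
    have hcard : #(D (flip t (σ a))) = #(D t) := by
      have : D (flip t (σ a)) = insert (σ a) ((D t).erase a) := by
        ext c
        by_cases e1 : c = a
        · subst e1
          simp [flip_prev, ha, (hσ c).symm]
        by_cases e2 : c = σ a
        · subst e2
          simp [flip_self, hσa]
        simp [flip_other t a c e1 e2, e1, e2]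
      rw [this, Finset.card_insert_of_notMem (by simp [hσa]), Finset.card_erase_add_one ha]
    refine isolated (flip t (σ a)) (fun t' => hcard ▸ ht t') (σ a) ((flip_self t a).2 hσa) ?_
    exact (flip_other t a _ hne (hσ _)).2 hc
  refine ⟨t, fun a ha h => h1 a ((hD _ _).2 ha) ((hD _ _).2 h), ?_⟩
  have d1 : Disjoint (D t) ((D t).map σ.toEmbedding) := by
    rw [Finset.disjoint_left]
    rintro c hc hc'
    obtain ⟨a, ha, rfl⟩ := Finset.mem_map.1 hc'
    exact h1 a ha hc
  have d2 : Disjoint (D t) ((D t).map (σ.trans σ).toEmbedding) := by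
    rw [Finset.disjoint_left]
    rintro c hc hc'
    obtain ⟨a, ha, rfl⟩ := Finset.mem_map.1 hc'
    exact h2 a ha hc
  have d3 : Disjoint ((D t).map σ.toEmbedding) ((D t).map (σ.trans σ).toEmbedding) := by
    rw [Finset.disjoint_left]
    rintro c hc hc'
    obtain ⟨a, ha, rfl⟩ := Finset.mem_map.1 hc
    obtain ⟨b, hb, hab⟩ := Finset.mem_map.1 hc'
    have hab : σ b = a := σ.injective hab
    exact h1 b hb (hab ▸ ha)
  have := Finset.card_le_univ (D t ∪ (D t).map σ.toEmbedding ∪ (D t).map (σ.trans σ).toEmbedding)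
  rw [Finset.card_union_of_disjoint (Finset.disjoint_union_left.2 ⟨d2, d3⟩),
    Finset.card_union_of_disjoint d1, Finset.card_map, Finset.card_map] at this
  have hsteps : #{a | t a = true} = #{a | t (σ a) = true} :=
    Finset.card_equiv σ.symm (by simp)
  have e1 : #{a | t a = true} = #{a | t a = true ∧ t (σ a) = true}
      + #{a | t a = true ∧ t (σ a) = false} := by
    rw [← Finset.card_filter_add_card_filter_not (s := {a | t a = true}) (fun a => t (σ a) = true)]
    simp only [Finset.filter_filter, Bool.not_eq_true]
  have e2 : #{a | t (σ a) = true} = #{a | t a = true ∧ t (σ a) = true}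
      + #{a | t a = false ∧ t (σ a) = true} := by
    rw [← Finset.card_filter_add_card_filter_not (s := {a | t (σ a) = true}) (fun a => t a = true)]
    simp only [Finset.filter_filter, Bool.not_eq_true, and_comm]
  have e3 : Fintype.card α = #(D t) + (#{a | t a = true ∧ t (σ a) = false}
      + #{a | t a = false ∧ t (σ a) = true}) := by
    have hdisj : Disjoint ({a | t a = true ∧ t (σ a) = false} : Finset α)
        ({a | t a = false ∧ t (σ a) = true} : Finset α) := by
      rw [Finset.disjoint_left]
      intro a ha ha'
      simp only [Finset.mem_filter] at ha ha'
      simp [ha.2.1] at ha'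
    rw [← Finset.card_union_of_disjoint hdisj, ← Finset.card_univ,
      ← Finset.card_filter_add_card_filter_not (fun a => t a = t (σ a))]
    congr 2
    ext a
    simp only [Finset.mem_filter, Finset.mem_univ, true_and, Finset.mem_union]
    cases t a <;> cases t (σ a) <;> simp
  change 3 * #(D t) ≤ _ ∧ _ ∧ _ ∧ #(D t) ≤ _ ∧ #(D t) ≤ _
  omega

/-- The elements of a finite type can be ranked `1, …, n` compatibly with any weight. -/
theorem exists_rank {α : Type*} [Fintype α] (q : α → ℤ) :
    ∃ r : α → ℤ, Function.Injective r ∧ (∀ a, 1 ≤ r a ∧ r a ≤ Fintype.card α) ∧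
      (∀ a b, r a < r b → q a ≤ q b) ∧
      (∀ a, r a ≤ #{b | q b ≤ q a}) ∧
      ∀ a, (Fintype.card α : ℤ) + 1 ≤ r a + #{b | q a ≤ q b} := by
  classical
  let e := Fintype.equivFin α
  let s := Tuple.sort (q ∘ e.symm)
  have hs : Monotone ((q ∘ e.symm) ∘ s) := Tuple.monotone_sort _
  let r : α ≃ Fin (Fintype.card α) := e.trans s.symm
  have hr : ∀ a b, r a ≤ r b → q a ≤ q b := fun a b h => by
    simpa [r] using hs h
  refine ⟨fun a => (r a : ℕ) + 1, fun a b h => ?_, fun a => ?_, fun a b h => ?_, fun a => ?_,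
    fun a => ?_⟩
  · exact r.injective (Fin.ext (by simpa using h))
  · have := (r a).isLt
    constructor <;> dsimp only <;> omega
  · exact hr a b (Fin.le_def.2 (by have : ((r a : ℕ) : ℤ) + 1 < (r b : ℕ) + 1 := h; omega))
  · have : #((Finset.Iic (r a)).map r.symm.toEmbedding) ≤ #{b | q b ≤ q a} := by
      refine Finset.card_le_card fun b hb => ?_
      obtain ⟨i, hi, rfl⟩ := Finset.mem_map.1 hb
      simpa using hr _ a (by simpa using hi)
    rw [Finset.card_map, Fin.card_Iic] at this
    dsimp only
    exact_mod_cast this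
  · have : #((Finset.Ici (r a)).map r.symm.toEmbedding) ≤ #{b | q a ≤ q b} := by
      refine Finset.card_le_card fun b hb => ?_
      obtain ⟨i, hi, rfl⟩ := Finset.mem_map.1 hb
      simpa using hr a _ (by simpa using hi)
    rw [Finset.card_map, Fin.card_Ici] at this
    have := (r a).isLt
    dsimp only
    omega

/-- Prescribed numbers on a set `D` and its image `σ D` extend to a numbering `1, …, n`. -/
theorem exists_numbering {α : Type*} [Fintype α] [DecidableEq α] (σ : Equiv.Perm α)
    (D : Finset α) (hD : ∀ a ∈ D, σ a ∉ D) (u v : α → ℤ)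
    (hu : ∀ a ∈ D, 1 ≤ u a ∧ u a ≤ Fintype.card α) (hv : ∀ a ∈ D, 1 ≤ v a ∧ v a ≤ Fintype.card α)
    (hui : ∀ a ∈ D, ∀ b ∈ D, u a = u b → a = b) (hvi : ∀ a ∈ D, ∀ b ∈ D, v a = v b → a = b)
    (huv : ∀ a ∈ D, ∀ b ∈ D, u a ≠ v b) :
    ∃ x : α → ℤ, Function.Injective x ∧ (∀ a, 1 ≤ x a ∧ x a ≤ Fintype.card α) ∧
      ∀ a ∈ D, x a = u a ∧ x (σ a) = v a := by
  let f : α → ℤ := fun a => if a ∈ D then u a else v (σ.symm a)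
  have f1 : ∀ a ∈ D, f a = u a := fun a ha => by simp [f, ha]
  have f2 : ∀ a ∈ D, f (σ a) = v a := fun a ha => by simp [f, hD a ha]
  have himage : (D ∪ D.map σ.toEmbedding).image f ⊆ Finset.Icc 1 (Fintype.card α : ℤ) := by
    intro y hy
    obtain ⟨b, hb, rfl⟩ := Finset.mem_image.1 hy
    rw [Finset.mem_Icc]
    rcases Finset.mem_union.1 hb with hb | hb
    · rw [f1 b hb]
      exact hu b hb
    · obtain ⟨a, ha, rfl⟩ := Finset.mem_map.1 hb
      change 1 ≤ f (σ a) ∧ f (σ a) ≤ _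
      rw [f2 a ha]
      exact hv a ha
  have hinj : Set.InjOn f ↑(D ∪ D.map σ.toEmbedding) := by
    intro b hb c hc hbc
    rcases Finset.mem_union.1 hb with hb | hb <;> rcases Finset.mem_union.1 hc with hc | hc
    · rw [f1 b hb, f1 c hc] at hbc
      exact hui b hb c hc hbc
    · obtain ⟨a, ha, rfl⟩ := Finset.mem_map.1 hc
      exact absurd ((f1 b hb).symm.trans (hbc.trans (f2 a ha))) (huv b hb a ha)
    · obtain ⟨a, ha, rfl⟩ := Finset.mem_map.1 hb
      exact absurd ((f1 c hc).symm.trans (hbc.symm.trans (f2 a ha))) (huv c hc a ha)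
    · obtain ⟨a, ha, rfl⟩ := Finset.mem_map.1 hb
      obtain ⟨a', ha', rfl⟩ := Finset.mem_map.1 hc
      rw [hvi a ha a' ha' ((f2 a ha).symm.trans (hbc.trans (f2 a' ha')))]
  obtain ⟨g, hg⟩ := Finset.exists_equiv_extend_of_card_eq (by simp) himage hinj
  refine ⟨fun a => g a, fun a b h => g.injective (Subtype.ext h), fun a => ?_, fun a ha => ?_⟩
  · exact Finset.mem_Icc.1 (g a).2
  · constructor
    · rw [← f1 a ha]
      exact hg a (by simp [ha])
    · rw [← f2 a ha]
      exact hg _ (by simp [ha])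

/-- A numbering of the edges of a bipartite graph that is a union of perfect matchings. -/
theorem isAntimagic_of_matchings {V ι : Type*} [Fintype V] [DecidableEq V] [Fintype ι]
    [DecidableEq ι] (G : SimpleGraph V) [DecidableRel G.Adj] (c : V → Bool)
    (hbip : ∀ u v, G.Adj u v → c u ≠ c v)
    (ψ : ι → {v // c v = true} ≃ {v // c v = false})
    (hψ : ∀ a b, G.Adj a.1 b.1 ↔ ∃ i, ψ i a = b)
    (hinj : ∀ a, Function.Injective fun i => ψ i a)
    (l : ι → {v // c v = true} → ℤ) (hl : Function.Injective fun p : ι × _ => l p.1 p.2)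
    (hrange : ∀ i a, 1 ≤ l i a ∧ l i a ≤ Fintype.card ι * Fintype.card {v // c v = true})
    (hA : Function.Injective fun a => ∑ i, l i a)
    (hB : Function.Injective fun b => ∑ i, l i ((ψ i).symm b))
    (hAB : ∀ a b, ∑ i, l i a ≠ ∑ i, l i ((ψ i).symm b)) : IsAntimagic G := by
  let E : ι × {v // c v = true} → Sym2 V := fun p => s(p.2.1, (ψ p.1 p.2).1)
  have hE : Function.Injective E := by
    rintro ⟨i, a⟩ ⟨j, b⟩ h
    rcases Sym2.eq_iff.1 h with ⟨h1, h2⟩ | ⟨h1, -⟩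
    · obtain rfl : a = b := Subtype.ext h1
      exact Prod.ext (hinj a (Subtype.ext h2)) rfl
    · have h3 : c a.1 = false := h1 ▸ (ψ j b).2
      simp [a.2] at h3
  have hadj : ∀ i a, G.Adj a.1 (ψ i a).1 := fun i a => (hψ _ _).2 ⟨i, rfl⟩
  have hedges : G.edgeFinset = univ.image E := by
    ext e
    induction e using Sym2.ind with | _ u v
    rw [SimpleGraph.mem_edgeFinset, SimpleGraph.mem_edgeSet, Finset.mem_image]
    constructor
    · intro h
      cases hu : c u
      · have hv : c v = true := by simpa [hu] using (hbip u v h).symm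
        obtain ⟨i, hi⟩ := (hψ ⟨v, hv⟩ ⟨u, hu⟩).1 h.symm
        exact ⟨(i, ⟨v, hv⟩), mem_univ _, by simp only [E, hi, Sym2.eq_swap]⟩
      · have hv : c v = false := by simpa [hu] using (hbip u v h).symm
        obtain ⟨i, hi⟩ := (hψ ⟨u, hu⟩ ⟨v, hv⟩).1 h
        exact ⟨(i, ⟨u, hu⟩), mem_univ _, by simp only [E, hi]⟩
    · rintro ⟨⟨i, a⟩, -, h⟩
      rw [← SimpleGraph.mem_edgeSet, ← h]
      exact hadj i a
  have hcard : #G.edgeFinset = Fintype.card ι * Fintype.card {v // c v = true} := by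
    rw [hedges, Finset.card_image_of_injective _ hE, Finset.card_univ, Fintype.card_prod]
  let f : Sym2 V → ℕ := Function.extend E (fun p => (l p.1 p.2).toNat) 0
  have hf : ∀ i a, (f (E (i, a)) : ℤ) = l i a := by
    intro i a
    have h : f (E (i, a)) = (l i a).toNat := hE.extend_apply _ _ _
    rw [h, Int.toNat_of_nonneg (by linarith [(hrange i a).1])]
  have hsumA : ∀ a : {v // c v = true}, (vertexSum G f a.1 : ℤ) = ∑ i, l i a := by
    intro a
    have : G.incidenceFinset a.1 = univ.image fun i => E (i, a) := by
      ext e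
      rw [SimpleGraph.mem_incidenceFinset, SimpleGraph.incidenceSet, Set.mem_sep_iff,
        ← SimpleGraph.mem_edgeFinset, hedges, Finset.mem_image, Finset.mem_image]
      constructor
      · rintro ⟨⟨⟨i, a'⟩, -, rfl⟩, h⟩
        rcases Sym2.mem_iff.1 h with h | h
        · exact ⟨i, mem_univ _, by rw [Subtype.ext h]⟩
        · have h3 : c a.1 = false := h ▸ (ψ i a').2
          simp [a.2] at h3
      · rintro ⟨i, -, rfl⟩
        exact ⟨⟨_, mem_univ _, rfl⟩, Sym2.mem_mk_left _ _⟩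
    rw [vertexSum, this, Finset.sum_image fun i _ j _ h => congrArg Prod.fst (hE h)]
    push_cast
    exact Finset.sum_congr rfl fun i _ => hf i a
  have hsumB : ∀ b : {v // c v = false},
      (vertexSum G f b.1 : ℤ) = ∑ i, l i ((ψ i).symm b) := by
    intro b
    have : G.incidenceFinset b.1 = univ.image fun i => E (i, (ψ i).symm b) := by
      ext e
      rw [SimpleGraph.mem_incidenceFinset, SimpleGraph.incidenceSet, Set.mem_sep_iff,
        ← SimpleGraph.mem_edgeFinset, hedges, Finset.mem_image, Finset.mem_image]
      constructor
      · rintro ⟨⟨⟨i, a'⟩, -, rfl⟩, h⟩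
        rcases Sym2.mem_iff.1 h with h | h
        · have h3 : c b.1 = true := h ▸ a'.2
          simp [b.2] at h3
        · exact ⟨i, mem_univ _, by rw [(Equiv.symm_apply_eq _).2 (Subtype.ext h)]⟩
      · rintro ⟨i, -, rfl⟩
        exact ⟨⟨_, mem_univ _, rfl⟩, by simp [E]⟩
    rw [vertexSum, this, Finset.sum_image fun i _ j _ h => congrArg Prod.fst (hE h)]
    push_cast
    exact Finset.sum_congr rfl fun i _ => hf i _
  have hmaps : Set.MapsTo f ↑G.edgeFinset ↑(Finset.Icc 1 #G.edgeFinset) := by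
    intro e he
    rw [Finset.mem_coe, hedges, Finset.mem_image] at he
    obtain ⟨⟨i, a⟩, -, rfl⟩ := he
    rw [Finset.mem_coe, Finset.mem_Icc, hcard]
    have h1 := hf i a
    have h2 := hrange i a
    rw [← h1] at h2
    exact_mod_cast h2
  have hinjOn : Set.InjOn f ↑G.edgeFinset := by
    intro e he e' he' h
    rw [Finset.mem_coe, hedges, Finset.mem_image] at he he'
    obtain ⟨⟨i, a⟩, -, rfl⟩ := he
    obtain ⟨⟨j, b⟩, -, rfl⟩ := he'
    have h1 : l i a = l j b := by rw [← hf, ← hf, h]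
    rw [hl (a₁ := (i, a)) (a₂ := (j, b)) h1]
  refine ⟨f, ⟨hmaps, hinjOn, Finset.surjOn_of_injOn_of_card_le f hmaps hinjOn (by simp)⟩, ?_⟩
  intro u v huv h
  have h : (vertexSum G f u : ℤ) = vertexSum G f v := by rw [h]
  cases hu : c u <;> cases hv : c v
  · rw [hsumB ⟨u, hu⟩, hsumB ⟨v, hv⟩] at h
    exact huv (congrArg Subtype.val (hB h))
  · rw [hsumB ⟨u, hu⟩, hsumA ⟨v, hv⟩] at h
    exact hAB _ _ h.symm
  · rw [hsumA ⟨u, hu⟩, hsumB ⟨v, hv⟩] at h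
    exact hAB _ _ h
  · rw [hsumA ⟨u, hu⟩, hsumA ⟨v, hv⟩] at h
    exact huv (congrArg Subtype.val (hA h))

/-- Pairs of matchings labelled with constant pair sums: their contribution is constant on one
side and bounded away from extreme values on the other. -/
theorem exists_pair_labeling {α : Type*} [Fintype α] (j : ℕ)
    (ρ : Fin j × Bool → Equiv.Perm α) (lo hi : ℤ)
    (h : lo + j * Fintype.card α < hi - j * Fintype.card α) :
    ∃ (w : Fin j × Bool → α → ℤ) (K : ℤ),
      (Function.Injective fun p : (Fin j × Bool) × α => w p.1 p.2) ∧
      (∀ i a, lo + 1 ≤ w i a ∧ w i a ≤ lo + j * Fintype.card α ∨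
        hi - j * Fintype.card α ≤ w i a ∧ w i a ≤ hi - 1) ∧
      (∀ a, ∑ i, w i a = K) ∧ ∀ b, |∑ i, w i (ρ i b) - K| ≤ j * Fintype.card α := by
  let e := Fintype.equivFin α
  let z : Fin j → α → ℤ := fun s a => (finProdFinEquiv (s, e a) : ℕ) + 1
  have hz : ∀ s a, 1 ≤ z s a ∧ z s a ≤ j * Fintype.card α := by
    intro s a
    have := (finProdFinEquiv (s, e a)).isLt
    simp only [z]
    exact ⟨by omega, by exact_mod_cast this⟩
  have hzi : ∀ s a s' a', z s a = z s' a' → s = s' ∧ a = a' := by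
    intro s a s' a' h
    have h : finProdFinEquiv (s, e a) = finProdFinEquiv (s', e a') :=
      Fin.ext (by simpa [z, -finProdFinEquiv_apply_val] using h)
    simpa using finProdFinEquiv.injective h
  have hzd : ∀ s a a', |z s a - z s a'| ≤ Fintype.card α := by
    intro s a a'
    have h1 := (e a).isLt
    have h2 := (e a').isLt
    simp only [z, finProdFinEquiv_apply_val]
    push_cast
    rw [abs_le]
    constructor <;> linarith
  let w : Fin j × Bool → α → ℤ := fun i a => if i.2 then hi - z i.1 a else lo + z i.1 a
  have hsum : ∀ f : Fin j × Bool → ℤ, ∑ i, f i = ∑ s, (f (s, true) + f (s, false)) := by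
    intro f
    rw [Fintype.sum_prod_type]
    simp
  refine ⟨w, j * (hi + lo), ?_, ?_, ?_, ?_⟩
  · rintro ⟨⟨s, x⟩, a⟩ ⟨⟨s', x'⟩, a'⟩ heq
    have h1 := hz s a
    have h2 := hz s' a'
    cases x <;> cases x' <;> simp only [w, if_true, Bool.false_eq_true, if_false] at heq
    · obtain ⟨rfl, rfl⟩ := hzi s a s' a' (by linarith)
      rfl
    · linarith
    · linarith
    · obtain ⟨rfl, rfl⟩ := hzi s a s' a' (by linarith)
      rfl
  · rintro ⟨s, x⟩ a
    have h1 := hz s a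
    cases x
    · left
      simp only [w, Bool.false_eq_true, if_false]
      constructor <;> linarith
    · right
      simp only [w, if_true]
      constructor <;> linarith
  · intro a
    rw [hsum]
    simp [w]
  · intro b
    rw [hsum]
    have : ∑ s, (w (s, true) (ρ (s, true) b) + w (s, false) (ρ (s, false) b)) - j * (hi + lo)
        = ∑ s, (z s (ρ (s, false) b) - z s (ρ (s, true) b)) := by
      have : (j : ℤ) * (hi + lo) = ∑ _s : Fin j, (hi + lo) := by simp
      rw [this, ← Finset.sum_sub_distrib]
      refine Finset.sum_congr rfl fun s _ => ?_
      simp only [w, if_true, Bool.false_eq_true, if_false]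
      ring
    rw [this]
    refine (Finset.abs_sum_le_sum_abs _ _).trans ?_
    refine (Finset.sum_le_sum fun s _ => hzd s _ _).trans ?_
    simp

/-- The elements of a finite set can be ranked `1, …, #D` compatibly with any weight. -/
theorem exists_rank_on {α : Type*} (D : Finset α) (q : α → ℤ) :
    ∃ r : α → ℤ, (∀ a ∈ D, ∀ b ∈ D, r a = r b → a = b) ∧ (∀ a ∈ D, 1 ≤ r a ∧ r a ≤ #D) ∧
      ∀ a ∈ D, ∀ b ∈ D, r a < r b → q a ≤ q b := by
  classical
  obtain ⟨r, hr, hb, hq, -⟩ := exists_rank fun a : D => q a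
  refine ⟨fun a => if h : a ∈ D then r ⟨a, h⟩ else 0, fun a ha b hb h => ?_, fun a ha => ?_,
    fun a ha b hb h => ?_⟩
  · simp only [ha, hb, dif_pos] at h
    exact congrArg Subtype.val (hr h)
  · simpa [ha] using hb ⟨a, ha⟩
  · simp only [ha, hb, dif_pos] at h
    exact hq _ _ h

/-- A numbering of the edges of a union of matchings such that all vertex sums are distinct: row
`i` lists the labels of the `i`-th matching, which joins the vertex `ρ i b` of one side to the
vertex `b` of the other. -/
structure IsAntimagicArray {ι α : Type*} [Fintype ι] [Fintype α] (ρ : ι → Equiv.Perm α)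
    (l : ι → α → ℤ) : Prop where
  injective : Function.Injective fun p : ι × α => l p.1 p.2
  range : ∀ i a, 1 ≤ l i a ∧ l i a ≤ Fintype.card ι * Fintype.card α
  left : Function.Injective fun a => ∑ i, l i a
  right : Function.Injective fun b => ∑ i, l i (ρ i b)
  left_ne_right : ∀ a b, ∑ i, l i a ≠ ∑ i, l i (ρ i b)

/-- The array for an odd number, at least three, of matchings. -/
theorem exists_antimagicArray_odd {α : Type*} [Fintype α] (j : ℕ)
    (ρ : Fin 3 ⊕ (Fin j × Bool) → Equiv.Perm α) (h0 : ρ (.inl 0) = 1)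
    (h1 : ∀ a, ρ (.inl 1) a ≠ a) : ∃ l, IsAntimagicArray ρ l := by
  classical
  set n : ℤ := (Fintype.card α : ℤ) with hn
  set J : ℤ := j * n with hJ
  have hJ0 : 0 ≤ J := by positivity
  set σ := ρ (.inl 1) with hσ
  obtain ⟨t, hiso, hd, -, -, hLL, hHH⟩ := exists_coloring_of_fixedPointFree σ h1
  set D : Finset α := {a | t a = t (σ a)} with hD
  have memD : ∀ a, a ∈ D ↔ t a = t (σ a) := by simp [hD]
  set d : ℤ := (#D : ℤ) with hdD
  obtain ⟨w, K, wi, wr, wA, wB⟩ := exists_pair_labeling j (fun i => ρ (.inr i)) n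
    (2 * J + 2 * n + 1)
    (by rw [← hn, ← hJ]; have : 0 ≤ n := by positivity
        linarith)
  rw [← hn, ← hJ] at wr wB
  set ν : α → ℤ := fun b => ∑ i, w i (ρ (.inr i) b) - K with hν
  have νb : ∀ b, -J ≤ ν b ∧ ν b ≤ J := fun b => abs_le.1 (wB b)
  obtain ⟨i, ii, ib, -⟩ := exists_rank_on D fun _ => 0
  obtain ⟨x, xi, xb, xD⟩ := exists_numbering σ D
    (fun a ha h => hiso a ((memD a).1 ha) ((memD _).1 h))
    (fun a => if 0 ≤ ν a ↔ t a = true then n - d + i a else i a)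
    (fun a => if 0 ≤ ν a ↔ t a = true then i a else n - d + i a)
    (fun a ha => by have := ib a ha; split_ifs <;> omega)
    (fun a ha => by have := ib a ha; split_ifs <;> omega)
    (fun a ha b hb h => ii a ha b hb <| by
      have := ib a ha; have := ib b hb; split_ifs at h <;> omega)
    (fun a ha b hb h => ii a ha b hb <| by
      have := ib a ha; have := ib b hb; split_ifs at h <;> omega)
    (fun a ha b hb h => by
      have := ib a ha; have := ib b hb
      by_cases hab : a = b
      · subst hab
        split_ifs at h <;> omega
      · have : i a ≠ i b := fun h => hab (ii a ha b hb h)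
        split_ifs at h <;> omega)
  set N : ℤ := 2 * J + 3 * n + 1 with hN
  set l0 : α → ℤ := fun a => if t a = true then x a else N - x a with hl0
  set l1 : α → ℤ := fun a => if t a = true then N - x a else x a with hl1
  set dev : α → ℤ := fun b => l0 b + l1 (σ b) + ν b - N with hdev
  have dev_low : ∀ b, t b = true → t (σ b) = false → dev b ≤ -J - n - 1 := by
    intro b h h'
    have := xb b; have := xb (σ b); have := νb b
    simp only [hdev, hl0, hl1, h, h', if_true, Bool.false_eq_true, if_false]
    omega
  have dev_high : ∀ b, t b = false → t (σ b) = true → n + J + 1 ≤ dev b := by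
    intro b h h'
    have := xb b; have := xb (σ b); have := νb b
    simp only [hdev, hl0, hl1, h, h', if_true, Bool.false_eq_true, if_false]
    omega
  have dev_mid : ∀ b, t b = t (σ b) → dev b ≤ -(n - d) ∨ n - d ≤ dev b := by
    intro b h
    have hx := xD b ((memD b).2 h)
    have hi := ib b ((memD b).2 h)
    cases h' : t b <;>
      simp only [hdev, hl0, hl1, ← h, hx, h', if_true, Bool.false_eq_true, if_false, iff_true,
        iff_false] <;>
      split_ifs <;> omega
  obtain ⟨r, ri, rb, rmono, rlow, rhigh⟩ := exists_rank dev
  have key : ∀ b, dev b + r b ≤ 0 ∨ n + 1 ≤ dev b + r b := by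
    intro b
    have hr := rb b
    rcases lt_trichotomy (dev b) 0 with h | h | h
    · left
      have hle : #{c | dev c ≤ dev b} + #{a | t a = false ∧ t (σ a) = true} ≤ Fintype.card α := by
        rw [← Finset.card_union_of_disjoint]
        · exact Finset.card_le_univ _
        · rw [Finset.disjoint_filter]
          intro c _ hc h'
          have := dev_high c h'.1 h'.2
          omega
      have := rlow b
      cases hb : t b <;> cases hb' : t (σ b)
      · have := dev_mid b (hb.trans hb'.symm)
        omega
      · have := dev_high b hb hb'
        omega
      · have := dev_low b hb hb'
        omega
      · have := dev_mid b (hb.trans hb'.symm)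
        omega
    · cases hb : t b <;> cases hb' : t (σ b)
      · have := dev_mid b (hb.trans hb'.symm)
        have : b ∈ D := (memD b).2 (hb.trans hb'.symm)
        have := Finset.card_pos.2 ⟨b, this⟩
        omega
      · have := dev_high b hb hb'
        omega
      · have := dev_low b hb hb'
        omega
      · have := dev_mid b (hb.trans hb'.symm)
        have : b ∈ D := (memD b).2 (hb.trans hb'.symm)
        have := Finset.card_pos.2 ⟨b, this⟩
        omega
    · right
      have hle : #{c | dev b ≤ dev c} + #{a | t a = true ∧ t (σ a) = false} ≤ Fintype.card α := by
        rw [← Finset.card_union_of_disjoint]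
        · exact Finset.card_le_univ _
        · rw [Finset.disjoint_filter]
          intro c _ hc h'
          have := dev_low c h'.1 h'.2
          omega
      have := rhigh b
      cases hb : t b <;> cases hb' : t (σ b)
      · have := dev_mid b (hb.trans hb'.symm)
        omega
      · have := dev_high b hb hb'
        omega
      · have := dev_low b hb hb'
        omega
      · have := dev_mid b (hb.trans hb'.symm)
        omega
  have devr : ∀ b b', dev b + r b = dev b' + r b' → b = b' := by
    intro b b' h
    by_contra hbb
    rcases lt_or_gt_of_ne (fun h => hbb (ri h)) with h' | h'
    · have := rmono _ _ h'
      omega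
    · have := rmono _ _ h'
      omega
  set l2 : α → ℤ := fun a => n + J + r ((ρ (.inl 2)).symm a) with hl2
  have l2inj : Function.Injective l2 := fun a b h =>
    (ρ (.inl 2)).symm.injective (ri (add_left_cancel h))
  have sumA : ∀ a, ∑ i, (Sum.elim ![l0, l1, l2] w : _ → α → ℤ) i a
      = N + K + n + J + r ((ρ (.inl 2)).symm a) := by
    intro a
    have : l0 a + l1 a = N := by
      simp only [hl0, hl1]
      split_ifs <;> ring
    simp [Fintype.sum_sum_type, Fin.sum_univ_three, wA, this, hl2]
    ring
  have sumB : ∀ b, ∑ i, (Sum.elim ![l0, l1, l2] w : _ → α → ℤ) i (ρ i b)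
      = N + K + n + J + (dev b + r b) := by
    intro b
    simp [Fintype.sum_sum_type, Fin.sum_univ_three, hdev, hl2, hν, h0, ← hσ]
    ring
  have rb2 := fun a => rb ((ρ (.inl 2)).symm a)
  refine ⟨Sum.elim ![l0, l1, l2] w, ?_, ?_, ?_, ?_, ?_⟩
  · rintro ⟨i | s, a⟩ ⟨i' | s', a'⟩ h
    · have := xb a; have := xb a'; have := rb2 a; have := rb2 a'
      by_cases haa : a = a'
      · subst haa
        cases hta : t a <;> fin_cases i <;> fin_cases i' <;>
          simp [hl0, hl1, hl2, hta] at h ⊢ <;> omega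
      · have : x a ≠ x a' := fun h => haa (xi h)
        have : l2 a ≠ l2 a' := fun h => haa (l2inj h)
        simp only [hl2] at this
        fin_cases i <;> fin_cases i' <;> simp [hl0, hl1, hl2, haa] at h ⊢ <;> omega
    · have := xb a; have := rb2 a; have := wr s' a'
      fin_cases i <;> simp [hl0, hl1, hl2] at h <;> omega
    · have := xb a'; have := rb2 a'; have := wr s a
      fin_cases i' <;> simp [hl0, hl1, hl2] at h <;> omega
    · obtain ⟨rfl, rfl⟩ := Prod.ext_iff.1 (wi (a₁ := (s, a)) (a₂ := (s', a')) h)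
      rfl
  · have hcard : (Fintype.card (Fin 3 ⊕ (Fin j × Bool)) : ℤ) * Fintype.card α = 3 * n + 2 * J := by
      simp [hJ, hn]
      ring
    rw [hcard]
    rintro (i | s) a
    · have := xb a; have := rb2 a
      fin_cases i <;> simp [hl0, hl1, hl2] <;> omega
    · have := wr s a
      dsimp only [Sum.elim_inr]
      omega
  · intro a b h
    simp only [sumA] at h
    exact (ρ (.inl 2)).symm.injective (ri (add_left_cancel h))
  · intro a b h
    simp only [sumB] at h
    exact devr _ _ (add_left_cancel h)
  · intro a b h
    rw [sumA, sumB] at h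
    have := key b
    have := rb ((ρ (.inl 2)).symm a)
    omega

/-- The array for an even number, at least four, of matchings. -/
theorem exists_antimagicArray_even {α : Type*} [Fintype α] (j : ℕ)
    (ρ : Fin 4 ⊕ (Fin j × Bool) → Equiv.Perm α) (h0 : ρ (.inl 0) = 1)
    (h1 : ∀ a, ρ (.inl 1) a ≠ a) : ∃ l, IsAntimagicArray ρ l := by
  classical
  set n : ℤ := (Fintype.card α : ℤ) with hn
  set J : ℤ := j * n with hJ
  have hJ0 : 0 ≤ J := by positivity
  set σ := ρ (.inl 1) with hσ
  obtain ⟨t, hiso, hd, hLL, hHH, -, -⟩ := exists_coloring_of_fixedPointFree σ h1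
  set D : Finset α := {a | t a = t (σ a)} with hD
  have memD : ∀ a, a ∈ D ↔ t a = t (σ a) := by simp [hD]
  obtain ⟨w, K, wi, wr, wA, wB⟩ := exists_pair_labeling j (fun i => ρ (.inr i)) n
    (3 * n + 2 * J + 1)
    (by rw [← hn, ← hJ]; have : 0 ≤ n := by positivity
        linarith)
  rw [← hn, ← hJ] at wr wB
  set ν : α → ℤ := fun b => ∑ i, w i (ρ (.inr i) b) - K with hν
  have νb : ∀ b, -J ≤ ν b ∧ ν b ≤ J := fun b => abs_le.1 (wB b)
  set ε : α → ℤ := fun b => (n + ν b) % 2 with hε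
  have ε0 : ∀ b, (ε b = 0 ∨ ε b = 1) ∧ (n + ε b + ν b) % 2 = 0 := by
    intro b
    simp only [hε]
    omega
  obtain ⟨i, ii, ib, iε⟩ := exists_rank_on D ε
  obtain ⟨x, xi, xb, xD⟩ := exists_numbering σ D
    (fun a ha h => hiso a ((memD a).1 ha) ((memD _).1 h))
    (fun a => i a + ε a) (fun a => n + 1 - i a)
    (fun a ha => by have := ib a ha; have := ε0 a; omega)
    (fun a ha => by have := ib a ha; omega)
    (fun a ha b hb h => by
      by_contra hab
      have h' : i a ≠ i b := fun h => hab (ii a ha b hb h)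
      have := ε0 a
      have := ε0 b
      rcases lt_or_gt_of_ne h' with h' | h'
      · have := iε a ha b hb h'
        omega
      · have := iε b hb a ha h'
        omega)
    (fun a ha b hb h => ii a ha b hb (by omega))
    (fun a ha b hb h => by
      have := ib a ha; have := ib b hb; have := ε0 a
      omega)
  set M : ℤ := 2 * J + 3 * n with hM
  set l0 : α → ℤ := fun a => if t a = true then x a else M + x a with hl0
  set l1 : α → ℤ := fun a => if t a = true then M + x a else x a with hl1
  set l2 : α → ℤ := fun a => n + J + 2 * (n - x a) + 1 with hl2
  set C : ℤ := M + n + J + 2 * n + 1 with hC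
  set dev : α → ℤ := fun b => l0 b + l1 (σ b) + l2 (ρ (.inl 2) b) + ν b - C with hdev
  have dev_low : ∀ b, t b = true → t (σ b) = false → dev b ≤ -J - n - 2 := by
    intro b h h'
    have := xb b; have := xb (σ b); have := xb (ρ (.inl 2) b); have := νb b
    have : x (σ b) ≠ x b := fun h => h1 b (xi h)
    simp only [hdev, hl0, hl1, hl2, h, h', if_true, Bool.false_eq_true, if_false]
    omega
  have dev_high : ∀ b, t b = false → t (σ b) = true → n + J + 2 ≤ dev b := by
    intro b h h'
    have := xb b; have := xb (σ b); have := xb (ρ (.inl 2) b); have := νb b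
    have : x (σ b) ≠ x b := fun h => h1 b (xi h)
    simp only [hdev, hl0, hl1, hl2, h, h', if_true, Bool.false_eq_true, if_false]
    omega
  have dev_mid : ∀ b, t b = t (σ b) → dev b % 2 = 1 ∧ 1 - n - J ≤ dev b ∧ dev b ≤ n + J := by
    intro b h
    have hx := xD b ((memD b).2 h)
    have := ε0 b; have := xb (ρ (.inl 2) b); have := νb b; have := xb (σ b); have := xb b
    have : dev b = x b + x (σ b) - 2 * x (ρ (.inl 2) b) + ν b := by
      simp only [hdev, hl0, hl1, hl2, ← h]
      split_ifs <;> omega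
    omega
  obtain ⟨r, ri, rb, rmono, rlow, rhigh⟩ := exists_rank dev
  have key : ∀ b, dev b % 2 = 1 ∨ dev b + 2 * r b < 2 ∨ 2 * n < dev b + 2 * r b := by
    intro b
    cases hb : t b <;> cases hb' : t (σ b)
    · exact Or.inl (dev_mid b (hb.trans hb'.symm)).1
    · have := dev_high b hb hb'
      have hle : #{c | dev b ≤ dev c} ≤ #{a | t a = false ∧ t (σ a) = true} := by
        refine Finset.card_le_card fun c hc => ?_
        rw [Finset.mem_filter] at hc ⊢
        refine ⟨mem_univ _, ?_⟩
        cases hc1 : t c <;> cases hc2 : t (σ c)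
        · have := dev_mid c (hc1.trans hc2.symm)
          omega
        · exact ⟨rfl, rfl⟩
        · have := dev_low c hc1 hc2
          omega
        · have := dev_mid c (hc1.trans hc2.symm)
          omega
      have := rhigh b
      omega
    · have := dev_low b hb hb'
      have hle : #{c | dev c ≤ dev b} ≤ #{a | t a = true ∧ t (σ a) = false} := by
        refine Finset.card_le_card fun c hc => ?_
        rw [Finset.mem_filter] at hc ⊢
        refine ⟨mem_univ _, ?_⟩
        cases hc1 : t c <;> cases hc2 : t (σ c)
        · have := dev_mid c (hc1.trans hc2.symm)
          omega
        · have := dev_high c hc1 hc2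
          omega
        · exact ⟨rfl, rfl⟩
        · have := dev_mid c (hc1.trans hc2.symm)
          omega
      have := rlow b
      omega
    · exact Or.inl (dev_mid b (hb.trans hb'.symm)).1
  have devr : ∀ b b', dev b + 2 * r b = dev b' + 2 * r b' → b = b' := by
    intro b b' h
    by_contra hbb
    rcases lt_or_gt_of_ne (fun h => hbb (ri h)) with h' | h'
    · have := rmono _ _ h'
      omega
    · have := rmono _ _ h'
      omega
  set l3 : α → ℤ := fun a => n + J + 2 * r ((ρ (.inl 3)).symm a) with hl3
  have l3inj : Function.Injective l3 := fun a b h =>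
    (ρ (.inl 3)).symm.injective (ri (by simp only [hl3] at h; omega))
  have sumA : ∀ a, ∑ i, (Sum.elim ![l0, l1, l2, l3] w : _ → α → ℤ) i a
      = C + K + n + J + 2 * r ((ρ (.inl 3)).symm a) := by
    intro a
    have : l0 a + l1 a + l2 a = C := by
      simp only [hl0, hl1, hl2]
      split_ifs <;> ring
    simp [Fintype.sum_sum_type, Fin.sum_univ_four, wA, this, hl3]
    ring
  have sumB : ∀ b, ∑ i, (Sum.elim ![l0, l1, l2, l3] w : _ → α → ℤ) i (ρ i b)
      = C + K + n + J + (dev b + 2 * r b) := by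
    intro b
    simp [Fintype.sum_sum_type, Fin.sum_univ_four, hdev, hl3, hν, h0, ← hσ]
    ring
  have rb3 := fun a => rb ((ρ (.inl 3)).symm a)
  refine ⟨Sum.elim ![l0, l1, l2, l3] w, ?_, ?_, ?_, ?_, ?_⟩
  · rintro ⟨i | s, a⟩ ⟨i' | s', a'⟩ h
    · have := xb a; have := xb a'; have := rb3 a; have := rb3 a'
      by_cases haa : a = a'
      · subst haa
        cases hta : t a <;> fin_cases i <;> fin_cases i' <;>
          simp [hl0, hl1, hl2, hl3, hta] at h ⊢ <;> omega
      · have : x a ≠ x a' := fun h => haa (xi h)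
        have : l3 a ≠ l3 a' := fun h => haa (l3inj h)
        simp only [hl3] at this
        fin_cases i <;> fin_cases i' <;> simp [hl0, hl1, hl2, hl3, haa] at h ⊢ <;> omega
    · have := xb a; have := rb3 a; have := wr s' a'
      fin_cases i <;> simp [hl0, hl1, hl2, hl3] at h <;> omega
    · have := xb a'; have := rb3 a'; have := wr s a
      fin_cases i' <;> simp [hl0, hl1, hl2, hl3] at h <;> omega
    · obtain ⟨rfl, rfl⟩ := Prod.ext_iff.1 (wi (a₁ := (s, a)) (a₂ := (s', a')) h)
      rfl
  · have hcard : (Fintype.card (Fin 4 ⊕ (Fin j × Bool)) : ℤ) * Fintype.card α = 4 * n + 2 * J := by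
      simp [hJ, hn]
      ring
    rw [hcard]
    rintro (i | s) a
    · have := xb a; have := rb3 a
      fin_cases i <;> simp [hl0, hl1, hl2, hl3] <;> omega
    · have := wr s a
      dsimp only [Sum.elim_inr]
      omega
  · intro a b h
    simp only [sumA] at h
    exact (ρ (.inl 3)).symm.injective (ri (by omega))
  · intro a b h
    simp only [sumB] at h
    exact devr _ _ (add_left_cancel h)
  · intro a b h
    rw [sumA, sumB] at h
    have := key b
    have := rb ((ρ (.inl 3)).symm a)
    omega

/-- A permutation encodes a union of even cycles; the edges of the cycles through its support can
be numbered so that all vertex sums are distinct. -/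
theorem exists_support_labeling {α : Type*} [Fintype α] [DecidableEq α] (σ : Equiv.Perm α) :
    ∃ l : Fin 2 → α → ℤ, (∀ i, ∀ a ∈ σ.support, 1 ≤ l i a ∧ l i a ≤ 2 * #σ.support) ∧
      (∀ i i', ∀ a ∈ σ.support, ∀ b ∈ σ.support, l i a = l i' b → i = i' ∧ a = b) ∧
      ∀ i i' : Fin 2, ∀ a ∈ σ.support, ∀ b ∈ σ.support,
        l 0 a + l 1 ((σ ^ (i : ℕ)) a) = l 0 b + l 1 ((σ ^ (i' : ℕ)) b) → i = i' ∧ a = b := by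
  induction σ using Equiv.Perm.cycle_induction_on with
  | base_one => exact ⟨0, by simp⟩
  | base_cycles σ hσ =>
    have hm := hσ.two_le_card_support
    obtain ⟨x, hx⟩ := hσ.nonempty_support
    have hx' := Equiv.Perm.mem_support.1 hx
    have hex : ∀ a, ∃ i, a ∈ σ.support → i < #σ.support ∧ (σ ^ i) x = a := by
      intro a
      by_cases ha : a ∈ σ.support
      · obtain ⟨i, hi, h⟩ := (hσ.sameCycle hx' (Equiv.Perm.mem_support.1 ha)).exists_pow_eq'
        rw [hσ.orderOf] at hi
        exact ⟨i, fun _ => ⟨hi, h⟩⟩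
      · exact ⟨0, fun h => absurd h ha⟩
    choose g hg using hex
    have hginj : ∀ a ∈ σ.support, ∀ b ∈ σ.support, g a = g b → a = b := by
      intro a ha b hb h
      rw [← (hg a ha).2, ← (hg b hb).2, h]
    have hgσ : ∀ a ∈ σ.support, g a + 1 < #σ.support ∧ g (σ a) = g a + 1 ∨
        g a + 1 = #σ.support ∧ g (σ a) = 0 := by
      intro a ha
      have h1 := hg a ha
      have h2 := hg (σ a) (Equiv.Perm.apply_mem_support.2 ha)
      have hmod : g (σ a) ≡ g a + 1 [MOD #σ.support] := by
        have hon : σ.IsCycleOn σ.support := by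
          simpa [hσ.cycleOf_eq hx'] using σ.isCycleOn_support_cycleOf x
        rw [← hon.pow_apply_eq_pow_apply hx, h2.2, pow_succ', Equiv.Perm.mul_apply,
          h1.2]
      rcases Nat.lt_or_ge (g a + 1) #σ.support with h | h
      · exact Or.inl ⟨h, hmod.eq_of_lt_of_lt h2.1 h⟩
      · have h3 : g a + 1 = #σ.support := by omega
        rw [h3] at hmod
        exact Or.inr ⟨h3, Nat.ModEq.eq_of_lt_of_lt
          (hmod.trans (by simp [Nat.ModEq])) h2.1 (by omega)⟩
    let f : ℤ → ℤ := fun p => if p < #σ.support then 2 * p + 1 else 2 * (2 * #σ.support - p)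
    refine ⟨![fun a => f (2 * g a + 1), fun a => f (2 * g a)], ?_, ?_, ?_⟩
    · intro i a ha
      have := hg a ha
      fin_cases i <;> simp [f] <;> omega
    · intro i i' a ha b hb h
      have := hg a ha
      have := hg b hb
      have : g a = g b → a = b := hginj a ha b hb
      have : g a = g b ∧ i = i' := by
        fin_cases i <;> fin_cases i' <;> simp [f] at h ⊢ <;> omega
      exact ⟨this.2, hginj a ha b hb this.1⟩
    · intro i i' a ha b hb h
      have := hg a ha
      have := hg b hb
      have := hgσ a ha
      have := hgσ b hb
      have : g a = g b ∧ i = i' := by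
        fin_cases i <;> fin_cases i' <;> simp [f] at h ⊢ <;> omega
      exact ⟨this.2, hginj a ha b hb this.1⟩
  | induction_disjoint σ τ hd _ hσ hτ =>
    obtain ⟨l, lb, li, ls⟩ := hσ
    obtain ⟨l', lb', li', ls'⟩ := hτ
    have hdisj := hd.disjoint_support
    have hpow : ∀ {f g : Equiv.Perm α}, f.Disjoint g → ∀ a ∈ f.support, ∀ i : ℕ,
        ((f * g) ^ i) a = (f ^ i) a ∧ (f ^ i) a ∈ f.support := by
      intro f g h a ha i
      have hga : g a = a := (h a).resolve_left (Equiv.Perm.mem_support.1 ha)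
      refine ⟨?_, Equiv.Perm.pow_apply_mem_support.2 ha⟩
      rw [h.commute.mul_pow, Equiv.Perm.mul_apply,
        Equiv.Perm.pow_apply_eq_self_of_apply_eq_self hga]
    have hσ' := fun a ha (i : Fin 2) => hpow hd a ha i
    have hτ' := fun a ha (i : Fin 2) => hpow hd.symm a ha i
    rw [hd.commute.symm.eq] at hτ'
    have hns : ∀ a ∈ τ.support, a ∉ σ.support := fun a h h' => Finset.disjoint_left.1 hdisj h' h
    rw [hd.card_support_mul, hd.support_mul]
    refine ⟨fun i a => if a ∈ σ.support then l i a else l' i a + 2 * #σ.support, ?_, ?_, ?_⟩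
    · intro i a ha
      rcases Finset.mem_union.1 ha with ha | ha
      · have := lb i a ha
        simp only [ha, if_true]
        omega
      · have := lb' i a ha
        simp only [hns a ha, if_false]
        omega
    · intro i i' a ha b hb h
      rcases Finset.mem_union.1 ha with ha | ha <;> rcases Finset.mem_union.1 hb with hb | hb
      · simp only [ha, hb, if_true] at h
        exact li i i' a ha b hb h
      · simp only [ha, hns b hb, if_true, if_false] at h
        have := lb i a ha; have := lb' i' b hb
        omega
      · simp only [hb, hns a ha, if_true, if_false] at h
        have := lb' i a ha; have := lb i' b hb
        omega
      · simp only [hns a ha, hns b hb, if_false] at h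
        exact li' i i' a ha b hb (by omega)
    · intro i i' a ha b hb h
      rcases Finset.mem_union.1 ha with ha | ha <;> rcases Finset.mem_union.1 hb with hb | hb
      · simp only [hσ' a ha, hσ' b hb, ha, hb, if_true] at h
        exact ls i i' a ha b hb h
      · simp only [hσ' a ha, hτ' b hb, ha, hns b hb, hns _ (hτ' b hb i').2, if_true, if_false] at h
        have := lb 0 a ha; have := lb' 0 b hb
        have := lb 1 _ (hσ' a ha i).2; have := lb' 1 _ (hτ' b hb i').2
        omega
      · simp only [hτ' a ha, hσ' b hb, hb, hns a ha, hns _ (hτ' a ha i).2, if_true, if_false] at h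
        have := lb' 0 a ha; have := lb 0 b hb
        have := lb' 1 _ (hτ' a ha i).2; have := lb 1 _ (hσ' b hb i').2
        omega
      · simp only [hτ' a ha, hτ' b hb, hns a ha, hns b hb, hns _ (hτ' a ha i).2,
          hns _ (hτ' b hb i').2, if_false] at h
        exact ls' i i' a ha b hb (by omega)

/-- The array for two matchings. -/
theorem exists_antimagicArray_two {α : Type*} [Fintype α]
    (ρ : Fin 2 → Equiv.Perm α) (h0 : ρ 0 = 1) (h1 : ∀ a, ρ 1 a ≠ a) :
    ∃ l, IsAntimagicArray ρ l := by
  classical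
  obtain ⟨l, lb, li, ls⟩ := exists_support_labeling (ρ 1)
  have hsupp : (ρ 1).support = univ := by ext; simp [h1]
  simp only [hsupp, mem_univ, true_implies, Finset.card_univ] at lb li ls
  refine ⟨l, ?_, ?_, ?_, ?_, ?_⟩
  · rintro ⟨i, a⟩ ⟨i', a'⟩ h
    obtain ⟨rfl, rfl⟩ := li i i' a a' h
    rfl
  · simpa using lb
  · intro a b h
    exact (ls 0 0 a b (by simpa using h)).2
  · intro a b h
    exact (ls 1 1 a b (by simpa [h0] using h)).2
  · intro a b h
    exact absurd (ls 0 1 a b (by simpa [h0] using h)).1 (by decide)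

/-- The edges of a regular bipartite graph split into perfect matchings. -/
theorem exists_matchings {V ι : Type*} [Fintype V] [DecidableEq V] [Fintype ι]
    (G : SimpleGraph V) [DecidableRel G.Adj] (c : V → Bool)
    (hbip : ∀ u v, G.Adj u v → c u ≠ c v) (hreg : G.IsRegularOfDegree (Fintype.card ι)) :
    ∃ ψ : ι → {v // c v = true} ≃ {v // c v = false},
      (∀ a b, G.Adj a.1 b.1 ↔ ∃ i, ψ i a = b) ∧ ∀ a, Function.Injective fun i => ψ i a := by
  let N : {v // c v = true} → Finset {v // c v = false} := fun a => {b | G.Adj a.1 b.1}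
  have hα : ∀ a, #(N a) = Fintype.card ι := by
    intro a
    rw [← hreg a.1, ← SimpleGraph.card_neighborFinset_eq_degree,
      ← Finset.card_map (Function.Embedding.subtype _)]
    congr 1
    ext v
    simpa [N, a.2] using fun h => by simpa [a.2] using (hbip _ _ h).symm
  have hβ : ∀ b, #{a | b ∈ N a} = Fintype.card ι := by
    intro b
    rw [← hreg b.1, ← SimpleGraph.card_neighborFinset_eq_degree,
      ← Finset.card_map (Function.Embedding.subtype _)]
    congr 1
    ext v
    simpa [N, b.2, G.adj_comm v] using fun h => by simpa [b.2] using (hbip _ _ h).symm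
  obtain ⟨ψ, h1, h2⟩ := exists_matching_decomposition_s17 (Fintype.card ι) N hα hβ
  let e := Fintype.equivFin ι
  refine ⟨fun i => ψ (e i), fun a b => ?_, fun a => (h2 a).comp e.injective⟩
  rw [← e.surjective.exists (p := fun i => ψ i a = b)]
  simpa [N] using h1 a b

/-- A suitable array for the matchings of a regular bipartite graph makes it antimagic. -/
theorem isAntimagic_of_forall_exists_antimagicArray {V ι : Type*} [Fintype V] [DecidableEq V]
    [Fintype ι] [DecidableEq ι] (i₀ i₁ : ι) (hi : i₁ ≠ i₀) (G : SimpleGraph V)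
    [DecidableRel G.Adj] (c : V → Bool) (hbip : ∀ u v, G.Adj u v → c u ≠ c v)
    (hreg : G.IsRegularOfDegree (Fintype.card ι))
    (H : ∀ ρ : ι → Equiv.Perm {v // c v = true}, ρ i₀ = 1 → (∀ a, ρ i₁ a ≠ a) →
      ∃ l, IsAntimagicArray ρ l) : IsAntimagic G := by
  obtain ⟨ψ, hψ, hinj⟩ := exists_matchings (ι := ι) G c hbip hreg
  obtain ⟨l, hl⟩ := H (fun i => (ψ i₀).trans (ψ i).symm) (by ext; simp) (fun a h => by
    have h : ψ i₀ a = ψ i₁ a := (Equiv.symm_apply_eq _).1 h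
    exact hi (hinj a h.symm))
  have hsum : ∀ b, ∑ i, l i ((ψ i).symm b)
      = ∑ i, l i (((ψ i₀).trans (ψ i).symm) ((ψ i₀).symm b)) := by simp
  refine isAntimagic_of_matchings G c hbip ψ hψ hinj l hl.injective hl.range hl.left ?_ ?_
  · intro b b' h
    simp only [hsum] at h
    exact (ψ i₀).symm.injective (hl.right h)
  · intro a b
    rw [hsum]
    exact hl.left_ne_right _ _

theorem stmt_17 {V : Type*} [Fintype V] [DecidableEq V] (G : SimpleGraph V)
    [DecidableRel G.Adj] (k : ℕ) (hk : 2 ≤ k)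
    (c : V → Bool) (hbip : ∀ u v, G.Adj u v → c u ≠ c v)
    (hreg : G.IsRegularOfDegree k) : IsAntimagic G := by
  obtain rfl | ⟨j, rfl⟩ | ⟨j, rfl⟩ : k = 2 ∨ (∃ j, k = 3 + j * 2) ∨ ∃ j, k = 4 + j * 2 := by
    obtain ⟨m, rfl⟩ := Nat.exists_eq_add_of_le hk
    obtain ⟨m, rfl | rfl⟩ := Nat.even_or_odd' m
    · cases m with
      | zero => exact Or.inl rfl
      | succ j => exact Or.inr (Or.inr ⟨j, by ring⟩)
    · exact Or.inr (Or.inl ⟨m, by ring⟩)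
  · exact isAntimagic_of_forall_exists_antimagicArray (ι := Fin 2) 0 1 (by decide) G c hbip
      (by simpa using hreg) fun ρ => exists_antimagicArray_two ρ
  · exact isAntimagic_of_forall_exists_antimagicArray (ι := Fin 3 ⊕ (Fin j × Bool)) (.inl 0)
      (.inl 1) (by simp) G c hbip (by simpa using hreg) fun ρ => exists_antimagicArray_odd j ρ
  · exact isAntimagic_of_forall_exists_antimagicArray (ι := Fin 4 ⊕ (Fin j × Bool)) (.inl 0)
      (.inl 1) (by simp) G c hbip (by simpa using hreg) fun ρ => exists_antimagicArray_even j ρ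
end
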